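/- For all real a, b, c with a + b + c = 2 and every ε > 0, one has Tr(ρ_ε · W̃[a,b,c]) = (ε + 1/ε − 2)/3 ≥ 0, with equality if and only if ε = 1. In particular, the family of PPT states ρ_ε never detects entanglement via the witnesses W̃[a,b,c]. -/

import Mathlib

open scoped ComplexOrder

/-- The (unnormalized) state
`ρ_ε = Σ_{i,j} |ii⟩⟨jj| + ε Σ_i |i,i+1⟩⟨i,i+1| + ε⁻¹ Σ_i |i,i+2⟩⟨i,i+2|`. -/
noncomputable def rho (ε : ℝ) : Matrix (Fin 3 × Fin 3) (Fin 3 × Fin 3) ℂ :=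
  Matrix.of fun p q =>
    (if p.1 = p.2 ∧ q.1 = q.2 then 1 else 0) +
      (if p = q ∧ p.2 = p.1 + 1 then (ε : ℂ) else 0) +
      (if p = q ∧ p.2 = p.1 + 2 then ((ε⁻¹ : ℝ) : ℂ) else 0)

/-- The entanglement witness `W̃[a,b,c]` as a `9 × 9` matrix indexed by pairs
`(i,j)` with `i, j ∈ Fin 3`: its diagonal entries in the order
`(1,1),(1,2),(1,3),(2,1),(2,2),(2,3),(3,1),(3,2),(3,3)` are
`a/6, b/6, c/6, b/6, c/6, a/6, c/6, a/6, b/6` (i.e. the entry at `(i,j)` is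
`![a,b,c] (i+j) / 6`), and its only off-diagonal nonzero entries are
`W̃[(i,i),(j,j)] = −1/6` for `i ≠ j`. -/
noncomputable def Wt (a b c : ℝ) : Matrix (Fin 3 × Fin 3) (Fin 3 × Fin 3) ℂ :=
  Matrix.of fun p q =>
    if p = q then ((![a, b, c] (p.1 + p.2) / 6 : ℝ) : ℂ)
    else if p.2 = p.1 ∧ q.2 = q.1 then ((-1 / 6 : ℝ) : ℂ) else 0

/-- for `a + b + c = 2` and `ε > 0`, one has
`Tr(ρ_ε · W̃[a,b,c]) = (ε + 1/ε − 2)/3 ≥ 0`, with equality iff `ε = 1`. -/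
theorem stmt14 (a b c : ℝ) (hsum : a + b + c = 2) (ε : ℝ) (hε : 0 < ε) :
    (rho ε * Wt a b c).trace = (((ε + ε⁻¹ - 2) / 3 : ℝ) : ℂ) ∧
      0 ≤ (ε + ε⁻¹ - 2) / 3 ∧ ((ε + ε⁻¹ - 2) / 3 = 0 ↔ ε = 1) := by
  have key : (ε + ε⁻¹ - 2) / 3 = (ε - 1) ^ 2 / (3 * ε) := by
    field_simp
    ring
  refine ⟨?_, ?_, ?_⟩
  · have hc : (c : ℂ) = 2 - a - b := by
      have : c = 2 - a - b := by linarith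
      rw [this]; push_cast; ring
    simp [Matrix.trace, Matrix.mul_apply, rho, Wt, Fintype.sum_prod_type, Fin.sum_univ_three,
      Prod.ext_iff]
    simp [hc, show (2 : Fin 3) + 2 = 1 from rfl, show (1 : Fin 3) + 2 = 0 from rfl,
      show (2 : Fin 3) + 1 = 0 from rfl, show (1 : Fin 3) + 1 = 2 from rfl]
    ring
  · rw [key]; positivity
  · rw [key]
    constructor
    · intro h
      have h3 : (3 * ε) ≠ 0 := by positivity
      have h2 : (ε - 1) ^ 2 = 0 := by
        rcases div_eq_zero_iff.mp h with h | h
        · exact h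
        · exact absurd h h3
      have := pow_eq_zero_iff (two_ne_zero) |>.mp h2
      linarith
    · rintro rfl; norm_num
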